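/- Let f : [a,b] → ℝ be absolutely continuous with derivative in L², and let g be a step function g(t) = Σ_{j=1}^p c_j 1_{(t_{j−1}, t_j]}(t) on a uniform partition t_j = a + j(b−a)/d of [a,b] into d pieces. Set Δ = f − g, with ‖Δ‖² = ∫_a^b Δ(x)² dx and ‖Δ‖_d² = ((b−a)/d) Σ_{l=1}^d Δ(t_l)². Then for every ε̃ > 0, ‖Δ‖² ≤ (1 + ε̃) ‖Δ‖_d² + (1 + 1/ε̃) (b−a)² ‖ḟ‖² / d². -/

import Mathlib

open MeasureTheory

/-- A function with square-integrable pointwise derivative has an integrable derivative. -/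
theorem intervalIntegrable_of_hasDerivAt_of_sq {f f' : ℝ → ℝ} {u v : ℝ} (huv : u ≤ v)
    (hf : ∀ x ∈ Set.Icc u v, HasDerivAt f (f' x) x)
    (hf' : IntervalIntegrable (fun x => (f' x) ^ 2) volume u v) :
    IntervalIntegrable f' volume u v := by
  have hm : AEStronglyMeasurable f' (volume.restrict (Set.uIoc u v)) := by
    refine (aestronglyMeasurable_deriv f _).congr ?_
    filter_upwards [ae_restrict_mem measurableSet_uIoc] with x hx
    rw [Set.uIoc_of_le huv] at hx
    exact (hf x (Set.Ioc_subset_Icc_self hx)).deriv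
  refine (intervalIntegrable_const (c := (1 : ℝ)) |>.add hf').mono_fun hm ?_
  filter_upwards with x
  rw [Real.norm_eq_abs, Real.norm_eq_abs]
  refine le_trans ?_ (le_abs_self _)
  rw [← sq_abs]
  nlinarith [sq_nonneg (|f' x| - 1), sq_nonneg |f' x|]

/-- The Cauchy–Schwarz inequality against the constant function `1` on an interval. -/
theorem sq_intervalIntegral_le {φ : ℝ → ℝ} {u v : ℝ} (huv : u ≤ v)
    (h₁ : IntervalIntegrable φ volume u v)
    (h₂ : IntervalIntegrable (fun x => (φ x) ^ 2) volume u v) :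
    (∫ x in u..v, φ x) ^ 2 ≤ (v - u) * ∫ x in u..v, (φ x) ^ 2 := by
  rcases huv.eq_or_lt with rfl | huv'
  · simp
  have hL : 0 < v - u := sub_pos.2 huv'
  set m : ℝ := (∫ x in u..v, φ x) / (v - u) with hm
  have h0 : 0 ≤ ∫ x in u..v, (φ x - m) ^ 2 :=
    intervalIntegral.integral_nonneg huv fun x _ => sq_nonneg _
  have h3 : (∫ x in u..v, (φ x - m) ^ 2) =
      (∫ x in u..v, (φ x) ^ 2) - 2 * m * (∫ x in u..v, φ x) + (v - u) * m ^ 2 := by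
    have : (fun x => (φ x - m) ^ 2) = fun x => (φ x) ^ 2 - 2 * m * φ x + m ^ 2 := by
      funext x; ring
    rw [this, intervalIntegral.integral_add (h₂.sub (h₁.const_mul _)) intervalIntegrable_const,
      intervalIntegral.integral_sub h₂ (h₁.const_mul _), intervalIntegral.integral_const_mul,
      intervalIntegral.integral_const, smul_eq_mul]
  have hB : (∫ x in u..v, φ x) = m * (v - u) := by rw [hm]; field_simp
  rw [h3, hB] at h0
  rw [hB]
  nlinarith

/-- Replacing `f - c` by its value at the right endpoint of an interval, in mean square. -/
theorem integral_sq_sub_const_le {f f' : ℝ → ℝ} {u v ε : ℝ} (huv : u ≤ v) (hε : 0 < ε)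
    (hf : ∀ x ∈ Set.Icc u v, HasDerivAt f (f' x) x)
    (hf' : IntervalIntegrable (fun x => (f' x) ^ 2) volume u v) (c : ℝ) :
    (∫ x in u..v, (f x - c) ^ 2) ≤ (1 + ε) * ((v - u) * (f v - c) ^ 2) +
      (1 + 1 / ε) * (v - u) ^ 2 * ∫ x in u..v, (f' x) ^ 2 := by
  have hcont : ContinuousOn f (Set.Icc u v) :=
    fun x hx => (hf x hx).continuousAt.continuousWithinAt
  have hint := intervalIntegrable_of_hasDerivAt_of_sq huv hf hf'
  have key : ∀ x ∈ Set.Icc u v, (f x - c) ^ 2 ≤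
      (1 + ε) * (f v - c) ^ 2 + (1 + 1 / ε) * ((v - u) * ∫ x in u..v, (f' x) ^ 2) := by
    intro x hx
    have hsub : Set.uIcc x v ⊆ Set.uIcc u v := by
      rw [Set.uIcc_of_le hx.2, Set.uIcc_of_le huv]
      exact Set.Icc_subset_Icc_left hx.1
    have hftc : (∫ t in x..v, f' t) = f v - f x :=
      intervalIntegral.integral_eq_sub_of_hasDerivAt
        (fun t ht => hf t (by simpa [Set.uIcc_of_le huv] using hsub ht)) (hint.mono_set hsub)
    have hcs := sq_intervalIntegral_le hx.2 (hint.mono_set hsub) (hf'.mono_set hsub)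
    rw [hftc] at hcs
    have hmono : (∫ t in x..v, (f' t) ^ 2) ≤ ∫ t in u..v, (f' t) ^ 2 :=
      intervalIntegral.integral_mono_interval hx.1 hx.2 le_rfl
        (Filter.Eventually.of_forall fun t => sq_nonneg (f' t)) hf'
    have hnn : 0 ≤ ∫ t in x..v, (f' t) ^ 2 :=
      intervalIntegral.integral_nonneg hx.2 fun t _ => sq_nonneg _
    have hcs' : (f v - f x) ^ 2 ≤ (v - u) * ∫ t in u..v, (f' t) ^ 2 :=
      hcs.trans (mul_le_mul (by linarith [hx.1]) hmono hnn (by linarith))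
    have hyoung : (f x - c) ^ 2 ≤ (1 + ε) * (f v - c) ^ 2 + (1 + 1 / ε) * (f v - f x) ^ 2 := by
      have : (1 + ε) * (f v - c) ^ 2 + (1 + 1 / ε) * (f v - f x) ^ 2 - (f x - c) ^ 2 =
          (ε * (f v - c) + (f v - f x)) ^ 2 / ε := by
        field_simp
        ring
      have := this ▸ (by positivity : 0 ≤ (ε * (f v - c) + (f v - f x)) ^ 2 / ε)
      linarith
    exact hyoung.trans (by gcongr)
  have hI : IntervalIntegrable (fun x => (f x - c) ^ 2) volume u v := by
    apply ContinuousOn.intervalIntegrable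
    rw [Set.uIcc_of_le huv]
    fun_prop
  have := intervalIntegral.integral_mono_on huv hI intervalIntegrable_const key
  rw [intervalIntegral.integral_const, smul_eq_mul] at this
  linarith

theorem continuous_vs_discrete_norm
    (a b : ℝ) (hab : a < b) (d : ℕ) (hd : 1 ≤ d)
    (f f' g : ℝ → ℝ)
    (hf : ∀ x ∈ Set.Icc a b, HasDerivAt f (f' x) x)
    (hf'2 : IntervalIntegrable (fun x => (f' x) ^ 2) volume a b)
    (p : ℕ) (c : ℕ → ℝ)
    (hg : ∀ j ∈ Finset.Icc 1 d,
      ∀ t ∈ Set.Ioc (a + ((j : ℝ) - 1) * (b - a) / d) (a + (j : ℝ) * (b - a) / d), g t = c j)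
    (ε : ℝ) (hε : 0 < ε) :
    (∫ x in a..b, (f x - g x) ^ 2) ≤
      (1 + ε) * (((b - a) / d) *
        ∑ l ∈ Finset.Icc 1 d, (f (a + (l : ℝ) * (b - a) / d) - g (a + (l : ℝ) * (b - a) / d)) ^ 2)
      + (1 + 1 / ε) * (b - a) ^ 2 * (∫ x in a..b, (f' x) ^ 2) / d ^ 2 := by
  have hd0 : (0 : ℝ) < d := by exact_mod_cast hd
  have hba : 0 < b - a := sub_pos.2 hab
  have hh : 0 < (b - a) / d := div_pos hba hd0
  set t : ℕ → ℝ := fun k => a + (k : ℝ) * (b - a) / d with ht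
  have ht0 : t 0 = a := by simp [ht]
  have htd : t d = b := by simp only [ht]; field_simp; ring
  have hstep : ∀ k, t (k + 1) - t k = (b - a) / d := fun k => by
    simp only [ht]; push_cast; ring
  have htmono : Monotone t := monotone_nat_of_le_succ fun k => by linarith [hstep k]
  have hle : ∀ k, t k ≤ t (k + 1) := fun k => htmono k.le_succ
  have hsub : ∀ k < d, Set.Icc (t k) (t (k + 1)) ⊆ Set.Icc a b := fun k hk =>
    Set.Icc_subset_Icc (ht0 ▸ htmono k.zero_le) (htd ▸ htmono hk)
  have hf'k : ∀ k < d, IntervalIntegrable (fun x => (f' x) ^ 2) volume (t k) (t (k + 1)) :=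
    fun k hk => hf'2.mono_set (by
      rw [Set.uIcc_of_le (hle k), Set.uIcc_of_le hab.le]; exact hsub k hk)
  have hgk : ∀ k < d, ∀ x ∈ Set.Ioc (t k) (t (k + 1)), g x = c (k + 1) := fun k hk x hx =>
    hg (k + 1) (Finset.mem_Icc.2 ⟨by omega, hk⟩) x (by simpa [ht] using hx)
  have heq : ∀ k < d, Set.EqOn (fun x => (f x - c (k + 1)) ^ 2) (fun x => (f x - g x) ^ 2)
      (Set.uIoc (t k) (t (k + 1))) := fun k hk x hx => by
    rw [Set.uIoc_of_le (hle k)] at hx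
    simp only [hgk k hk x hx]
  have hΔk : ∀ k < d, IntervalIntegrable (fun x => (f x - g x) ^ 2) volume (t k) (t (k + 1)) := by
    intro k hk
    have hcont : ContinuousOn f (Set.Icc (t k) (t (k + 1))) :=
      fun x hx => (hf x (hsub k hk hx)).continuousAt.continuousWithinAt
    have : IntervalIntegrable (fun x => (f x - c (k + 1)) ^ 2) volume (t k) (t (k + 1)) := by
      apply ContinuousOn.intervalIntegrable
      rw [Set.uIcc_of_le (hle k)]
      fun_prop
    exact this.congr (heq k hk)
  have hpiece : ∀ k ∈ Finset.range d, (∫ x in t k..t (k + 1), (f x - g x) ^ 2) ≤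
      (1 + ε) * ((b - a) / d * (f (t (k + 1)) - g (t (k + 1))) ^ 2) +
        (1 + 1 / ε) * ((b - a) / d) ^ 2 * ∫ x in t k..t (k + 1), (f' x) ^ 2 := by
    intro k hk
    have hk := Finset.mem_range.1 hk
    have := integral_sq_sub_const_le (hle k) hε (fun x hx => hf x (hsub k hk hx)) (hf'k k hk)
      (c (k + 1))
    rw [hstep k, intervalIntegral.integral_congr_ae (.of_forall (heq k hk))] at this
    rwa [hgk k hk (t (k + 1)) ⟨by linarith [hstep k], le_rfl⟩]
  have hsum := Finset.sum_le_sum hpiece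
  rw [intervalIntegral.sum_integral_adjacent_intervals hΔk, Finset.sum_add_distrib,
    ← Finset.mul_sum, ← Finset.mul_sum, ← Finset.mul_sum,
    intervalIntegral.sum_integral_adjacent_intervals hf'k, ht0, htd] at hsum
  have hshift : ∑ l ∈ Finset.Icc 1 d, (f (t l) - g (t l)) ^ 2 =
      ∑ k ∈ Finset.range d, (f (t (k + 1)) - g (t (k + 1))) ^ 2 := by
    rw [Finset.range_eq_Ico, Finset.sum_Ico_add' (fun l => (f (t l) - g (t l)) ^ 2) 0 d 1]
    rfl
  rw [hshift]
  refine hsum.trans_eq ?_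
  rw [div_pow]
  ring
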